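/- arXiv:math/9912103 — 2 statements merged into one kernel-verified Lean document; each statement's English description precedes it below -/
import Mathlib

section
/- Let $c > 1$ and let $a : \mathbb{N} \to \mathbb{N}$ satisfy $a(n+1) > c \cdot a(n)$ for all $n$. Let $k \ge 2$. For any $N \ge 2$, the number of solutions to $\sum_{i=1}^{k-1} m_i (a(n_i) - a(n_{i+1})) = \sum_{i=1}^{k-1} m'_i (a(n'_i) - a(n'_{i+1}))$ with $m_i, m'_i \in \mathbb{Z}$, $(m, m') \ne (0, \dots, 0)$, $n_1, \dots, n_k$ distinct positive integers, $n'_1, \dots, n'_k$ distinct positive integers, and all variables bounded in absolute value by $N$, is at most $C(k,c) \cdot N^{2k-1} (\log N)^{2k-1}$. -/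
/-- Solutions `(w, x)` of `∑ i, w i * a (x i) = 0` with nonzero coefficients bounded by `M` and
indices in `[1, N]`, such that on each fibre of `g` the coefficients sum to zero and the indices
are distinct. -/
def zeroSumSolutions (a : ℕ → ℕ) (M N : ℕ) {ι : Type*} [Fintype ι] (g : ι → Bool) :
    Set ((ι → ℤ) × (ι → ℕ)) :=
  {p | (∀ i, p.1 i ≠ 0) ∧ (∀ i, |p.1 i| ≤ M) ∧ (∀ i, p.2 i ∈ Finset.Icc 1 N) ∧
    (∀ i j, g i = g j → p.2 i = p.2 j → i = j) ∧
    (∀ b, ∑ i, (if g i = b then p.1 i else 0) = 0) ∧ ∑ i, p.1 i * (a (p.2 i) : ℤ) = 0}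

lemma abs_prefix_sum_le {a : ℕ → ℕ} (ha : Monotone a) {M r : ℕ} {w : Fin (r + 2) → ℤ}
    {x : Fin (r + 2) → ℕ} (hx : Antitone x) (hw : ∀ i, |w i| ≤ M)
    (h0 : ∑ i, w i * (a (x i) : ℤ) = 0) {i j : Fin (r + 2)} (hij : j.1 = i.1 + 1) :
    |∑ l ∈ Finset.Iio i, w l * (a (x l) : ℤ) + w i * a (x i)| ≤ (r + 2) * M * a (x j) := by
  have h1 : ∑ l ∈ Finset.Iio i, w l * (a (x l) : ℤ) + w i * a (x i) =
      ∑ l ∈ Finset.Iic i, w l * (a (x l) : ℤ) := by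
    rw [← Finset.Iio_insert, Finset.sum_insert (by simp), add_comm]
  have h2 := Finset.sum_add_sum_compl (Finset.Iic i) (fun l => w l * (a (x l) : ℤ))
  rw [h0] at h2
  rw [h1, eq_neg_of_add_eq_zero_left h2, abs_neg]
  calc _ ≤ ∑ l ∈ (Finset.Iic i)ᶜ, |w l * (a (x l) : ℤ)| := Finset.abs_sum_le_sum_abs _ _
    _ ≤ ∑ l ∈ (Finset.Iic i)ᶜ, (M : ℤ) * a (x j) := by
        refine Finset.sum_le_sum fun l hl => ?_
        rw [abs_mul, Nat.abs_cast]
        have hjl : j ≤ l := by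
          simp only [Finset.mem_compl, Finset.mem_Iic, not_le, Fin.lt_def] at hl
          rw [Fin.le_def]; omega
        have := ha (hx hjl)
        have := hw l
        gcongr
    _ ≤ ∑ l : Fin (r + 2), (M : ℤ) * a (x j) :=
        Finset.sum_le_sum_of_subset_of_nonneg (Finset.subset_univ _) fun _ _ _ => by positivity
    _ = _ := by simp [mul_assoc]

/-- Records a coefficient and the next index. If the gap is less than `L`, keep the coefficient
and the gap; otherwise keep the next index and the distance of the coefficient from a quotient
determined by the preceding terms. -/
def stepCode (a : ℕ → ℕ) (L : ℕ) {r : ℕ} (p : (Fin (r + 2) → ℤ) × (Fin (r + 2) → ℕ))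
    (i j : Fin (r + 2)) : (ℤ × ℕ) ⊕ (ℤ × ℕ) :=
  if p.2 i - p.2 j < L then Sum.inl (p.1 i, p.2 i - p.2 j)
  else Sum.inr (p.1 i + (∑ l ∈ Finset.Iio i, p.1 l * (a (p.2 l) : ℤ)) / a (p.2 i), p.2 j)

lemma stepCode_inj {a : ℕ → ℕ} {L r : ℕ} {p q : (Fin (r + 2) → ℤ) × (Fin (r + 2) → ℕ)}
    (hp : Antitone p.2) (hq : Antitone q.2) {i j : Fin (r + 2)} (hij : i ≤ j)
    (hw : ∀ l < i, p.1 l = q.1 l) (hx : ∀ l ≤ i, p.2 l = q.2 l)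
    (h : stepCode a L p i j = stepCode a L q i j) : p.1 i = q.1 i ∧ p.2 j = q.2 j := by
  have hS : ∑ l ∈ Finset.Iio i, p.1 l * (a (p.2 l) : ℤ) =
      ∑ l ∈ Finset.Iio i, q.1 l * (a (q.2 l) : ℤ) :=
    Finset.sum_congr rfl fun l hl => by
      rw [Finset.mem_Iio] at hl
      rw [hw l hl, hx l hl.le]
  have h1 := hp hij
  have h2 := hq hij
  have h3 := hx i le_rfl
  unfold stepCode at h
  rw [hS, h3] at h
  rw [h3] at h1
  split_ifs at h <;> simp only [Sum.inl.injEq, Sum.inr.injEq, Prod.mk.injEq] at h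
  · exact ⟨h.1, by omega⟩
  · exact ⟨by linarith [h.1], h.2⟩

lemma stepCode_mem {a : ℕ → ℕ} (ha : Monotone a) (hpos : ∀ n, 0 < a n) {M N B L r : ℕ}
    (hB : (r + 2) * M ≤ B) (hL : ∀ u v, u + L ≤ v → B * a u ≤ a v) {g : Fin (r + 2) → Bool}
    {p : (Fin (r + 2) → ℤ) × (Fin (r + 2) → ℕ)} (hp : p ∈ zeroSumSolutions a M N g)
    (hanti : Antitone p.2) {i j : Fin (r + 2)} (hij : j.1 = i.1 + 1) :
    stepCode a L p i j ∈ (Finset.Icc (-M : ℤ) M ×ˢ Finset.range L).disjSum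
      (Finset.Icc (-2 : ℤ) 2 ×ˢ Finset.Icc 1 N) := by
  obtain ⟨-, hw, hN, -, -, h0⟩ := hp
  unfold stepCode
  split_ifs with h
  · simpa [h] using abs_le.1 (hw i)
  · rw [Finset.inr_mem_disjSum, Finset.mem_product]
    refine ⟨?_, hN j⟩
    have h1 := abs_prefix_sum_le ha hanti hw h0 hij
    set S := ∑ l ∈ Finset.Iio i, p.1 l * (a (p.2 l) : ℤ)
    have h2 : ((r : ℤ) + 2) * M * a (p.2 j) ≤ a (p.2 i) := by
      have : p.2 j ≤ p.2 i := hanti (by rw [Fin.le_def]; omega)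
      exact_mod_cast (Nat.mul_le_mul_right _ hB).trans (hL (p.2 j) (p.2 i) (by omega))
    have hA : (0 : ℤ) < a (p.2 i) := by exact_mod_cast hpos _
    have h3 := Int.mul_ediv_add_emod S (a (p.2 i))
    have h4 := Int.emod_nonneg S hA.ne'
    have h5 := Int.emod_lt_of_pos S hA
    have h6 := abs_le.1 (h1.trans h2)
    simp only [Finset.mem_Icc]
    constructor <;> by_contra! h7 <;> nlinarith

lemma last_step_inj {a : ℕ → ℕ} (ha : StrictMono a) {M N B L r : ℕ}
    (hB : 2 * M < B) (hL : ∀ u v, u + L ≤ v → B * a u ≤ a v) {g : Fin (r + 2) → Bool}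
    {p q : (Fin (r + 2) → ℤ) × (Fin (r + 2) → ℕ)} (hp : p ∈ zeroSumSolutions a M N g)
    (hq : q ∈ zeroSumSolutions a M N g) (hpa : Antitone p.2) (hqa : Antitone q.2)
    (hw : ∀ l : Fin r, p.1 l.castSucc.castSucc = q.1 l.castSucc.castSucc)
    (hx : ∀ l : Fin (r + 1), p.2 l.castSucc = q.2 l.castSucc)
    (h : min (p.2 (Fin.last r).castSucc - p.2 (Fin.last (r + 1))) L =
      min (q.2 (Fin.last r).castSucc - q.2 (Fin.last (r + 1))) L) : p = q := by
  obtain ⟨hp0, hpM, hpN, hpi, hpg, hpS⟩ := hp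
  obtain ⟨hq0, hqM, hqN, hqi, hqg, hqS⟩ := hq
  have hg : ∀ b, (if g (Fin.last r).castSucc = b then p.1 (Fin.last r).castSucc else 0) +
      (if g (Fin.last (r + 1)) = b then p.1 (Fin.last (r + 1)) else 0) =
      (if g (Fin.last r).castSucc = b then q.1 (Fin.last r).castSucc else 0) +
      (if g (Fin.last (r + 1)) = b then q.1 (Fin.last (r + 1)) else 0) := by
    intro b
    have h1 := hpg b
    have h2 := hqg b
    rw [Fin.sum_univ_castSucc, Fin.sum_univ_castSucc] at h1 h2
    simp only [hw] at h1
    linarith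
  have hS : p.1 (Fin.last r).castSucc * (a (q.2 (Fin.last r).castSucc) : ℤ) +
      p.1 (Fin.last (r + 1)) * (a (p.2 (Fin.last (r + 1))) : ℤ) =
      q.1 (Fin.last r).castSucc * (a (q.2 (Fin.last r).castSucc) : ℤ) +
      q.1 (Fin.last (r + 1)) * (a (q.2 (Fin.last (r + 1))) : ℤ) := by
    rw [Fin.sum_univ_castSucc, Fin.sum_univ_castSucc] at hpS hqS
    simp only [hw, hx] at hpS
    linarith
  have hle : (Fin.last r).castSucc ≤ Fin.last (r + 1) := Fin.le_last _
  have hne : (Fin.last r).castSucc ≠ Fin.last (r + 1) := (Fin.castSucc_lt_last _).ne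
  have hpx := hpa hle
  have hqx := hqa hle
  have hgp := hpi (Fin.last r).castSucc (Fin.last (r + 1))
  have hgq := hqi (Fin.last r).castSucc (Fin.last (r + 1))
  have hxl := hx (Fin.last r)
  have hpM' := hpM (Fin.last (r + 1))
  have hqM' := hqM (Fin.last (r + 1))
  have hp0' := hp0 (Fin.last (r + 1))
  rw [hxl] at h hpx hgp
  suffices key : p.1 (Fin.last r).castSucc = q.1 (Fin.last r).castSucc ∧
      p.1 (Fin.last (r + 1)) = q.1 (Fin.last (r + 1)) ∧
      p.2 (Fin.last (r + 1)) = q.2 (Fin.last (r + 1)) by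
    refine Prod.ext (funext fun i => ?_) (funext fun i => ?_)
    · induction i using Fin.lastCases with
      | last => exact key.2.1
      | cast i =>
        induction i using Fin.lastCases with
        | last => exact key.1
        | cast i => exact hw i
    · induction i using Fin.lastCases with
      | last => exact key.2.2
      | cast i => exact hx i
  generalize p.1 (Fin.last r).castSucc = u at *
  generalize q.1 (Fin.last r).castSucc = u' at *
  generalize p.1 (Fin.last (r + 1)) = v at *
  generalize q.1 (Fin.last (r + 1)) = v' at *
  generalize q.2 (Fin.last r).castSucc = X at *
  generalize p.2 (Fin.last (r + 1)) = Y at *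
  generalize q.2 (Fin.last (r + 1)) = Y' at *
  have haY : ∀ Y Y', v * (a Y : ℤ) = v * (a Y' : ℤ) → Y = Y' := fun Y Y' h =>
    ha.injective (by exact_mod_cast mul_left_cancel₀ hp0' h)
  by_cases hgg : g (Fin.last r).castSucc = g (Fin.last (r + 1))
  · have huv : u + v = u' + v' := by simpa [hgg] using hg (g (Fin.last (r + 1)))
    have hYX : Y < X := lt_of_le_of_ne hpx fun e => hne (hgp hgg e.symm)
    have hYX' : Y' < X := lt_of_le_of_ne hqx fun e => hne (hgq hgg e.symm)
    have hAY : (a Y : ℤ) < a X := by exact_mod_cast ha hYX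
    have hvv : v = v' := by
      by_cases hd : X - Y < L
      · obtain rfl : Y = Y' := by omega
        have : (v - v') * ((a X : ℤ) - a Y) = 0 := by
          obtain rfl : u = u' + v' - v := by linarith
          linarith
        rcases mul_eq_zero.1 this with h | h <;> linarith
      · have h1 : (B : ℤ) * a Y ≤ a X := by exact_mod_cast hL Y X (by omega)
        have h2 : (B : ℤ) * a Y' ≤ a X := by exact_mod_cast hL Y' X (by omega)
        have h3 : (v - v') * (a X : ℤ) = v * a Y - v' * a Y' := by
          obtain rfl : u = u' + v' - v := by linarith
          linarith
        have hX : (0 : ℤ) < a X := lt_of_le_of_lt (by positivity) hAY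
        have h4 : |v * (a Y : ℤ) - v' * a Y'| ≤ M * a Y + M * a Y' := by
          refine (abs_sub _ _).trans ?_
          rw [abs_mul, abs_mul, Nat.abs_cast, Nat.abs_cast]
          gcongr
        have hB' : (2 * M + 1 : ℤ) ≤ B := by exact_mod_cast hB
        have h6 : |v - v'| < 1 := by
          by_contra! h7
          rw [← h3, abs_mul, Nat.abs_cast] at h4
          have h8 : (a X : ℤ) ≤ M * a Y + M * a Y' := by nlinarith
          have h9 : (2 : ℤ) * (M * a Y + M * a Y') + (a Y + a Y') ≤ 2 * a X := by nlinarith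
          have h10 : (0 : ℤ) ≤ a Y := by positivity
          have h11 : (0 : ℤ) ≤ a Y' := by positivity
          have h12 : (a Y : ℤ) = 0 := by linarith
          have h13 : (a Y' : ℤ) = 0 := by linarith
          rw [h12, h13] at h8
          linarith
        linarith [Int.abs_lt_one_iff.1 h6]
    subst hvv
    obtain rfl : u = u' := by linarith
    exact ⟨rfl, rfl, haY _ _ (by linarith)⟩
  · have hu : u = u' := by simpa [Ne.symm hgg] using hg (g (Fin.last r).castSucc)
    have hv : v = v' := by simpa [hgg] using hg (g (Fin.last (r + 1)))
    subst hu hv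
    exact ⟨rfl, rfl, haY _ _ (by linarith)⟩

lemma encard_antitone_zeroSumSolutions_le {a : ℕ → ℕ} (ha : StrictMono a) (hpos : ∀ n, 0 < a n)
    {M N B L r : ℕ} (hB : (r + 2) * M ≤ B) (hB' : 2 * M < B)
    (hL : ∀ u v, u + L ≤ v → B * a u ≤ a v) (g : Fin (r + 2) → Bool) :
    (zeroSumSolutions a M N g ∩ {p | Antitone p.2}).encard ≤
      (N * (((2 * M + 1) * L + 5 * N) ^ r * (L + 1)) : ℕ) := by
  set K := (Finset.Icc (-M : ℤ) M ×ˢ Finset.range L).disjSum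
    (Finset.Icc (-2 : ℤ) 2 ×ˢ Finset.Icc 1 N) with hK
  have hKc : K.card = (2 * M + 1) * L + 5 * N := by
    simp [hK, Finset.card_disjSum]
    left
    omega
  have hc : (Finset.Icc 1 N ×ˢ (Fintype.piFinset (fun _ : Fin r => K)) ×ˢ
      Finset.range (L + 1)).card = N * (((2 * M + 1) * L + 5 * N) ^ r * (L + 1)) := by
    simp [Finset.card_product, hKc]
  rw [← hc, ← Set.encard_coe_eq_coe_finsetCard]
  refine Set.encard_le_encard_of_injOn (f := fun p => (p.2 0,
    fun t : Fin r => stepCode a L p t.castSucc.castSucc t.castSucc.succ,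
    min (p.2 (Fin.last r).castSucc - p.2 (Fin.last (r + 1))) L)) ?_ ?_
  · rintro p ⟨hp, hpa⟩
    have h0 := hp.2.2.1 0
    simp only [Finset.coe_product, Set.mem_prod, Finset.mem_coe, Fintype.mem_piFinset]
    exact ⟨h0, fun t => stepCode_mem ha.monotone hpos hB hL hp hpa (by simp), by simp⟩
  · rintro p ⟨hp, hpa⟩ q ⟨hq, hqa⟩ h
    simp only [Prod.mk.injEq] at h
    obtain ⟨h0, hs, hl⟩ := h
    have key : ∀ t : ℕ, t ≤ r → (∀ l : Fin (r + 2), l.1 < t → p.1 l = q.1 l) ∧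
        (∀ l : Fin (r + 2), l.1 ≤ t → p.2 l = q.2 l) := by
      intro t
      induction t with
      | zero =>
        refine fun _ => ⟨fun l hl => by omega, fun l hl => ?_⟩
        obtain rfl : l = 0 := Fin.ext (by simpa using hl)
        exact h0
      | succ t ih =>
        intro ht
        obtain ⟨ihw, ihx⟩ := ih (by omega)
        have := stepCode_inj hpa hqa (i := (⟨t, ht⟩ : Fin r).castSucc.castSucc)
          (by rw [Fin.le_def]; simp) (fun l hl => ihw l hl) (fun l hl => ihx l hl)
          (congrFun hs ⟨t, ht⟩)
        refine ⟨fun l hl => ?_, fun l hl => ?_⟩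
        · rcases Nat.lt_succ_iff_lt_or_eq.1 hl with h | h
          · exact ihw l h
          · have hlt : l = (⟨t, ht⟩ : Fin r).castSucc.castSucc := Fin.ext h
            rw [hlt]
            exact this.1
        · rcases Nat.le_succ_iff.1 hl with h | h
          · exact ihx l h
          · have hlt : l = (⟨t, ht⟩ : Fin r).castSucc.succ := Fin.ext h
            rw [hlt]
            exact this.2
    obtain ⟨kw, kx⟩ := key r le_rfl
    exact last_step_inj ha hB' hL hp hq hpa hqa (fun l => kw _ l.2)
      (fun l => kx _ (Nat.lt_succ_iff.1 l.2)) hl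

lemma encard_le_card_mul {α κ : Type*} [Fintype κ] {S : Set α} {T : κ → Set α} {B : ℕ}
    (hT : ∀ i, (T i).encard ≤ B) (hS : ∀ p ∈ S, ∃ i, p ∈ T i) :
    S.encard ≤ (Fintype.card κ * B : ℕ) := by
  classical
  have hf : ∀ i, (T i).Finite := fun i => Set.finite_of_encard_le_coe (hT i)
  have hsub : S ⊆ ((Finset.univ.biUnion fun i => (hf i).toFinset : Finset α) : Set α) := by
    intro p hp
    simpa using hS p hp
  refine (Set.encard_le_encard hsub).trans ?_
  rw [Set.encard_coe_eq_coe_finsetCard, Nat.cast_le]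
  refine Finset.card_biUnion_le_card_mul _ _ _ fun i _ => ?_
  have := hT i
  rwa [(hf i).encard_eq_coe_toFinset_card, Nat.cast_le] at this

lemma zeroSumSolutions_comp {a : ℕ → ℕ} {M N : ℕ} {ι ι' : Type*} [Fintype ι] [Fintype ι']
    {g : ι → Bool} (e : ι' ≃ ι) {p : (ι → ℤ) × (ι → ℕ)} (hp : p ∈ zeroSumSolutions a M N g) :
    (p.1 ∘ e, p.2 ∘ e) ∈ zeroSumSolutions a M N (g ∘ e) := by
  obtain ⟨h1, h2, h3, h4, h5, h6⟩ := hp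
  refine ⟨fun i => h1 _, fun i => h2 _, fun i => h3 _,
    fun i j hg hx => e.injective (h4 _ _ hg hx), fun b => ?_, ?_⟩
  · exact (e.sum_comp fun i => if g i = b then p.1 i else 0).trans (h5 b)
  · exact (e.sum_comp fun i => p.1 i * (a (p.2 i) : ℤ)).trans h6

lemma encard_zeroSumSolutions_le {a : ℕ → ℕ} (ha : StrictMono a) (hpos : ∀ n, 0 < a n)
    {N B L : ℕ} (hN : 1 ≤ N) (hL1 : 1 ≤ L) {ι : Type*} [Fintype ι] [Nonempty ι]
    (hB : Fintype.card ι * (2 * N) ≤ B) (hB' : 4 * N < B)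
    (hL : ∀ u v, u + L ≤ v → B * a u ≤ a v) (g : ι → Bool) :
    (zeroSumSolutions a (2 * N) N g).encard ≤
      ((Fintype.card ι).factorial * (10 * N * L) ^ (Fintype.card ι - 1) : ℕ) := by
  classical
  obtain h1 | ⟨r, hr⟩ : Fintype.card ι = 1 ∨ ∃ r, Fintype.card ι = r + 2 := by
    have := Fintype.card_pos (α := ι)
    rcases h : Fintype.card ι with _ | _ | r
    · omega
    · exact Or.inl rfl
    · exact Or.inr ⟨r, rfl⟩
  · obtain ⟨i, hi⟩ := Fintype.card_eq_one_iff.1 h1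
    have : zeroSumSolutions a (2 * N) N g = ∅ := by
      refine Set.eq_empty_of_forall_notMem fun p hp => hp.1 i ?_
      have h := hp.2.2.2.2.1 (g i)
      have : (Finset.univ : Finset ι) = {i} := by ext j; simp [hi j]
      simpa [this] using h
    simp [this]
  · have hN2 : (((2 * (2 * N) + 1) * L + 5 * N)) ≤ 10 * N * L := by nlinarith
    have hN3 : N * (L + 1) ≤ 10 * N * L := by nlinarith
    have hc : Fintype.card (Fin (r + 2) ≃ ι) = (r + 2).factorial := by
      rw [Fintype.card_equiv (Fintype.equivFinOfCardEq hr).symm, Fintype.card_fin]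
    rw [hr, ← hc]
    refine encard_le_card_mul (T := fun e : Fin (r + 2) ≃ ι =>
      {p | p ∈ zeroSumSolutions a (2 * N) N g ∧ Antitone (p.2 ∘ e)}) (fun e => ?_) fun p hp => ?_
    · refine (Set.encard_le_encard_of_injOn (f := fun p => (p.1 ∘ e, p.2 ∘ e))
        (t := zeroSumSolutions a (2 * N) N (g ∘ e) ∩ {p | Antitone p.2}) ?_ ?_).trans ?_
      · exact fun p hp => ⟨zeroSumSolutions_comp e hp.1, hp.2⟩
      · intro p _ q _ h
        simp only [Prod.mk.injEq] at h
        exact Prod.ext (e.surjective.injective_comp_right h.1)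
          (e.surjective.injective_comp_right h.2)
      · refine (encard_antitone_zeroSumSolutions_le (B := B) (L := L) ha hpos (by rwa [← hr])
          (by omega) hL _).trans ?_
        rw [Nat.cast_le]
        calc _ ≤ N * ((10 * N * L) ^ r * (L + 1)) := by gcongr
          _ = (10 * N * L) ^ r * (N * (L + 1)) := by ring
          _ ≤ (10 * N * L) ^ r * (10 * N * L) := by gcongr
          _ = _ := by rw [← pow_succ]; rfl
    · let e₀ := (Fintype.equivFinOfCardEq hr).symm
      refine ⟨(Tuple.sort (OrderDual.toDual ∘ p.2 ∘ e₀)).trans e₀, hp, fun i j hij => ?_⟩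
      exact Tuple.monotone_sort (OrderDual.toDual ∘ p.2 ∘ e₀) hij

lemma encard_zeroSum_ne_zero_le {a : ℕ → ℕ} (ha : StrictMono a) (hpos : ∀ n, 0 < a n)
    {N B L : ℕ} (hN : 1 ≤ N) (hL1 : 1 ≤ L) {ι : Type*} [Fintype ι]
    (hB : Fintype.card ι * (2 * N) ≤ B) (hB' : 4 * N < B)
    (hL : ∀ u v, u + L ≤ v → B * a u ≤ a v) (g : ι → Bool) :
    {p : (ι → ℤ) × (ι → ℕ) | p.1 ≠ 0 ∧ (∀ i, |p.1 i| ≤ (2 * N : ℕ)) ∧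
      (∀ i, p.2 i ∈ Finset.Icc 1 N) ∧ (∀ i j, g i = g j → p.2 i = p.2 j → i = j) ∧
      (∀ b, ∑ i, (if g i = b then p.1 i else 0) = 0) ∧
      ∑ i, p.1 i * (a (p.2 i) : ℤ) = 0}.encard ≤
    (2 ^ Fintype.card ι * ((Fintype.card ι).factorial *
      (N ^ (Fintype.card ι - 1) * (10 * L) ^ (Fintype.card ι - 1))) : ℕ) := by
  classical
  rw [← Fintype.card_finset]
  refine encard_le_card_mul (T := fun U : Finset ι => {p : (ι → ℤ) × (ι → ℕ) | p.1 ≠ 0 ∧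
      (∀ i, |p.1 i| ≤ (2 * N : ℕ)) ∧
      (∀ i, p.2 i ∈ Finset.Icc 1 N) ∧ (∀ i j, g i = g j → p.2 i = p.2 j → i = j) ∧
      (∀ b, ∑ i, (if g i = b then p.1 i else 0) = 0) ∧
      ∑ i, p.1 i * (a (p.2 i) : ℤ) = 0 ∧ ∀ i, i ∈ U ↔ p.1 i ≠ 0}) (fun U => ?_) fun p hp => ?_
  · rcases U.eq_empty_or_nonempty with rfl | hU
    · refine le_of_eq_of_le ?_ bot_le
      refine Set.encard_eq_zero.2 ?_
      refine Set.eq_empty_of_forall_notMem fun p hp => hp.1 (funext fun i => ?_)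
      simpa using hp.2.2.2.2.2.2 i
    · have : Nonempty U := hU.to_subtype
      have hUc : U.card ≤ Fintype.card ι := Finset.card_le_univ U
      have hU1 := hU.card_pos
      have hsol := encard_zeroSumSolutions_le (ι := U) (B := B) ha hpos hN hL1
        (by rw [Fintype.card_coe]; exact (Nat.mul_le_mul_right _ hUc).trans hB) hB' hL
        (fun i => g i)
      refine (Set.encard_le_encard_of_injOn (f := fun p : (ι → ℤ) × (ι → ℕ) =>
        ((fun i : {i // i ∉ U} => p.2 i), ((fun i : U => p.1 i), (fun i : U => p.2 i))))
        (t := ((Fintype.piFinset (fun _ : {i // i ∉ U} => Finset.Icc 1 N) : Finset _) : Set _) ×ˢ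
          zeroSumSolutions a (2 * N) N (fun i : U => g i)) ?_ ?_).trans ?_
      · rintro p ⟨-, h2, h3, h4, h5, h6, h7⟩
        have hsum : ∀ f : ι → ℤ, (∀ i, p.1 i = 0 → f i = 0) → ∑ i : U, f i = ∑ i, f i :=
          fun f hf => by
            rw [Finset.sum_coe_sort U f]
            exact Finset.sum_subset (Finset.subset_univ _) fun i _ hi =>
              hf i (by simpa using (h7 i).not.1 hi)
        refine ⟨?_, fun i => (h7 i).1 i.2, fun i => h2 _, fun i => h3 _,
          fun i j hg hx => Subtype.ext (h4 _ _ hg hx), fun b => ?_, ?_⟩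
        · exact Finset.mem_coe.2 (Fintype.mem_piFinset.2 fun i => h3 i)
        · exact (hsum (fun i => if g i = b then p.1 i else 0) fun i hi => by simp [hi]).trans (h5 b)
        · exact (hsum (fun i => p.1 i * (a (p.2 i) : ℤ)) fun i hi => by simp [hi]).trans h6
      · rintro p hp q hq h
        simp only [Prod.mk.injEq] at h
        obtain ⟨h1, h2, h3⟩ := h
        refine Prod.ext (funext fun i => ?_) (funext fun i => ?_)
        · by_cases hi : i ∈ U
          · exact congrFun h2 ⟨i, hi⟩
          · have e1 := (hp.2.2.2.2.2.2 i).not.1 hi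
            have e2 := (hq.2.2.2.2.2.2 i).not.1 hi
            push Not at e1 e2
            rw [e1, e2]
        · by_cases hi : i ∈ U
          · exact congrFun h3 ⟨i, hi⟩
          · exact congrFun h1 ⟨i, hi⟩
      · rw [Set.encard_prod, Set.encard_coe_eq_coe_finsetCard]
        refine (mul_le_mul_right hsol _).trans ?_
        rw [← Nat.cast_mul, Nat.cast_le]
        simp only [Fintype.card_piFinset, Nat.card_Icc, Finset.prod_const, Finset.card_univ,
          Fintype.card_coe, Fintype.card_subtype_compl, add_tsub_cancel_right]
        calc N ^ (Fintype.card ι - U.card) * (U.card.factorial * (10 * N * L) ^ (U.card - 1))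
            = U.card.factorial * (N ^ (Fintype.card ι - U.card) * N ^ (U.card - 1) *
                (10 * L) ^ (U.card - 1)) := by
              rw [show 10 * N * L = N * (10 * L) by ring, mul_pow]; ring
          _ = U.card.factorial * (N ^ (Fintype.card ι - 1) * (10 * L) ^ (U.card - 1)) := by
              rw [← pow_add]; congr 3; omega
          _ ≤ _ := by
              have : 1 ≤ 10 * L := by omega
              gcongr
  · exact ⟨Finset.univ.filter fun i => p.1 i ≠ 0, hp.1, hp.2.1, hp.2.2.1, hp.2.2.2.1,
      hp.2.2.2.2.1, hp.2.2.2.2.2, fun i => by simp⟩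

/-- The coefficients obtained from `m` by summation by parts. -/
def partsCoeff {n : ℕ} (m : Fin n → ℤ) : Fin (n + 1) → ℤ :=
  (Fin.snoc m 0 : Fin (n + 1) → ℤ) - (Fin.cons 0 m : Fin (n + 1) → ℤ)

lemma sum_partsCoeff_mul {n : ℕ} (m : Fin n → ℤ) (f : Fin (n + 1) → ℤ) :
    ∑ i, partsCoeff m i * f i = ∑ i : Fin n, m i * (f i.castSucc - f i.succ) := by
  simp only [partsCoeff, Pi.sub_apply, sub_mul, mul_sub, Finset.sum_sub_distrib]
  congr 1
  · rw [Fin.sum_univ_castSucc]; simp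
  · rw [Fin.sum_univ_succ]; simp

lemma partsCoeff_injective {n : ℕ} :
    Function.Injective (partsCoeff : (Fin n → ℤ) → Fin (n + 1) → ℤ) := by
  intro m m' h
  have key : ∀ t (ht : t < n), m ⟨t, ht⟩ = m' ⟨t, ht⟩ := by
    intro t
    induction t with
    | zero =>
      intro ht
      have := congrFun h (Fin.castSucc ⟨0, ht⟩)
      have h0 : Fin.castSucc (⟨0, ht⟩ : Fin n) = 0 := rfl
      simp only [partsCoeff, Pi.sub_apply, Fin.snoc_castSucc] at this
      simpa [h0] using this
    | succ t ih =>
      intro ht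
      have := congrFun h (Fin.castSucc ⟨t + 1, ht⟩)
      have h0 : Fin.castSucc (⟨t + 1, ht⟩ : Fin n) = Fin.succ ⟨t, by omega⟩ := rfl
      simp only [partsCoeff, Pi.sub_apply, Fin.snoc_castSucc] at this
      rw [h0, Fin.cons_succ, Fin.cons_succ, ih (by omega)] at this
      exact sub_left_injective this
  exact funext fun i => key i i.2

lemma abs_partsCoeff_le {n N : ℕ} {m : Fin n → ℤ} (hm : ∀ i, |m i| ≤ (N : ℤ)) (i : Fin (n + 1)) :
    |partsCoeff m i| ≤ (2 * N : ℕ) := by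
  have h1 : |(Fin.snoc m 0 : Fin (n + 1) → ℤ) i| ≤ N := by
    induction i using Fin.lastCases with
    | last => simp
    | cast i => simpa using hm i
  have h2 : |(Fin.cons 0 m : Fin (n + 1) → ℤ) i| ≤ N := by
    induction i using Fin.cases with
    | zero => simp
    | succ i => simpa using hm i
  refine (abs_sub _ _).trans ?_
  push_cast
  linarith

lemma exists_lacunary_gap {c : ℝ} (hc : 1 < c) {k : ℕ} (hk : 1 ≤ k) :
    ∃ C : ℝ, ∀ a : ℕ → ℕ, (∀ n, c * a n < a (n + 1)) → ∀ N : ℕ, 2 ≤ N →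
      ∃ L : ℕ, 1 ≤ L ∧ (L : ℝ) ≤ C * Real.log N ∧
        ∀ u v, u + L ≤ v → 4 * k * N * a u ≤ a v := by
  refine ⟨(Real.log (4 * k) / Real.log 2 + 1) / Real.log c + 1 / Real.log 2,
    fun a ha N hN => ⟨⌈Real.log (4 * k * N) / Real.log c⌉₊, ?_, ?_, ?_⟩⟩
  all_goals
    have hlc := Real.log_pos hc
    have hl2 : 0 < Real.log 2 := Real.log_pos (by norm_num)
    have hkR : (1 : ℝ) ≤ k := by exact_mod_cast hk
    have hNR : (2 : ℝ) ≤ N := by exact_mod_cast hN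
    have hpos : 0 < Real.log (4 * k * N) := Real.log_pos (by nlinarith)
  · exact Nat.one_le_ceil_iff.2 (by positivity)
  · refine (Nat.ceil_lt_add_one (by positivity)).le.trans ?_
    have hlN : Real.log 2 ≤ Real.log N := Real.log_le_log (by norm_num) hNR
    have h4k : 0 ≤ Real.log (4 * k) := Real.log_nonneg (by linarith)
    have h1 : 1 ≤ 1 / Real.log 2 * Real.log N := by
      rw [one_div, inv_mul_eq_div, one_le_div hl2]; exact hlN
    rw [Real.log_mul (by positivity) (by positivity), add_mul]
    refine add_le_add ?_ h1
    rw [div_mul_eq_mul_div]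
    gcongr
    rw [add_mul, one_mul]
    gcongr
    calc Real.log (4 * k) ≤ Real.log (4 * k) * (1 / Real.log 2 * Real.log N) :=
          le_mul_of_one_le_right h4k h1
      _ = _ := by ring
  · intro u v huv
    have hmono : Monotone a := monotone_nat_of_le_succ fun n => by
      have := ha n
      have h0 : (0 : ℝ) ≤ a n := by positivity
      have : (a n : ℝ) ≤ a (n + 1) := by nlinarith
      exact_mod_cast this
    have hpow : ∀ d, c ^ d * a u ≤ a (u + d) := by
      intro d
      induction d with
      | zero => simp
      | succ d ih =>
        calc c ^ (d + 1) * a u = c * (c ^ d * a u) := by ring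
          _ ≤ c * a (u + d) := by gcongr
          _ ≤ _ := (ha (u + d)).le
    have hcL : (4 * k * N : ℝ) ≤ c ^ ⌈Real.log (4 * k * N) / Real.log c⌉₊ := by
      rw [← Real.log_le_log_iff (by positivity) (by positivity), Real.log_pow,
        ← div_le_iff₀ hlc]
      exact Nat.le_ceil _
    have : (4 * k * N * a u : ℝ) ≤ a v :=
      (mul_le_mul_of_nonneg_right hcL (by positivity)).trans
        ((hpow _).trans (by exact_mod_cast hmono huv))
    exact_mod_cast this

/-- Main counting lemma: for a lacunary sequence `a` with ratio `c > 1`, the number of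
solutions of `∑ mᵢ (a(nᵢ) - a(nᵢ₊₁)) = ∑ m'ᵢ (a(n'ᵢ) - a(n'ᵢ₊₁))` with `(m,m') ≠ 0`,
the `nᵢ` distinct, the `n'ᵢ` distinct, all variables bounded by `N`, is
`O_{k,c}(N^(2k-1) (log N)^(2k-1))`. -/
theorem stmt3 (c : ℝ) (hc : 1 < c) (k : ℕ) (hk : 2 ≤ k) :
    ∃ κ : ℝ, ∀ (a : ℕ → ℕ), (∀ n, 0 < a n) → (∀ n, c * a n < a (n + 1)) →
      ∀ (N : ℕ), 2 ≤ N →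
        (Set.ncard {q : ((Fin (k-1) → ℤ) × (Fin k → ℕ)) × ((Fin (k-1) → ℤ) × (Fin k → ℕ)) |
            (q.1.1, q.2.1) ≠ 0 ∧
            Function.Injective q.1.2 ∧ Function.Injective q.2.2 ∧
            (∀ i, |q.1.1 i| ≤ (N : ℤ)) ∧ (∀ i, |q.2.1 i| ≤ (N : ℤ)) ∧
            (∀ i, 1 ≤ q.1.2 i ∧ q.1.2 i ≤ N) ∧ (∀ i, 1 ≤ q.2.2 i ∧ q.2.2 i ≤ N) ∧
            (∑ i : Fin (k-1), q.1.1 i *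
                ((a (q.1.2 ⟨i.1, by have := i.2; omega⟩) : ℤ) -
                 (a (q.1.2 ⟨i.1 + 1, by have := i.2; omega⟩) : ℤ))) =
            (∑ i : Fin (k-1), q.2.1 i *
                ((a (q.2.2 ⟨i.1, by have := i.2; omega⟩) : ℤ) -
                 (a (q.2.2 ⟨i.1 + 1, by have := i.2; omega⟩) : ℤ)))} : ℝ)
          ≤ κ * (N : ℝ) ^ (2 * k - 1) * (Real.log N) ^ (2 * k - 1) := by
  obtain ⟨n, rfl⟩ : ∃ n, k = n + 1 := ⟨k - 1, by omega⟩
  obtain ⟨C, hC⟩ := exists_lacunary_gap hc (k := n + 1) (by omega)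
  refine ⟨2 ^ (2 * (n + 1)) * (2 * (n + 1)).factorial * (10 * C) ^ (2 * (n + 1) - 1),
    fun a hpos ha N hN => ?_⟩
  obtain ⟨L, hL1, hLC, hL⟩ := hC a ha N hN
  have hmono : StrictMono a := strictMono_nat_of_lt_succ fun m => by
    have h1 := ha m
    have h2 : (0 : ℝ) < a m := by exact_mod_cast hpos m
    have : (a m : ℝ) < a (m + 1) := by nlinarith
    exact_mod_cast this
  have hcard : Fintype.card (Fin (n + 1) ⊕ Fin (n + 1)) = 2 * (n + 1) := by simp; ring
  have hbound := encard_zeroSum_ne_zero_le (ι := Fin (n + 1) ⊕ Fin (n + 1))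
    (N := N) (L := L) (B := 4 * (n + 1) * N) hmono hpos (by omega) hL1
    (by rw [hcard]; apply le_of_eq; ring)
    (by nlinarith) hL Sum.isLeft
  rw [hcard] at hbound
  refine le_trans (Nat.cast_le.2 (ENat.toNat_le_of_le_natCast ((Set.encard_le_encard_of_injOn
    (f := fun q : ((Fin n → ℤ) × (Fin (n + 1) → ℕ)) × ((Fin n → ℤ) × (Fin (n + 1) → ℕ)) =>
      (Sum.elim (partsCoeff q.1.1) (-partsCoeff q.2.1), Sum.elim q.1.2 q.2.2)) ?_ ?_).trans
    hbound))) ?_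
  · rintro ⟨⟨m, x⟩, ⟨m', x'⟩⟩ ⟨h0, hx, hx', hm, hm', hN1, hN2, heq⟩
    simp only at h0 hx hx' hm hm' hN1 hN2 heq
    have hzero : ∀ b : Fin n → ℤ, ∑ i, partsCoeff b i = 0 := fun b => by
      simpa using sum_partsCoeff_mul b 1
    refine ⟨fun h => h0 ?_, ?_, ?_, ?_, ?_, ?_⟩
    · have hp0 : partsCoeff (0 : Fin n → ℤ) = 0 := by
        funext i
        have := abs_partsCoeff_le (N := 0) (m := (0 : Fin n → ℤ)) (by simp) i
        simpa using this
      refine Prod.ext (partsCoeff_injective ?_) (partsCoeff_injective ?_)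
      · exact (funext fun i => congrFun h (Sum.inl i)).trans hp0.symm
      · refine (funext fun i => ?_).trans hp0.symm
        simpa using congrFun h (Sum.inr i)
    · rintro (i | i)
      · exact abs_partsCoeff_le hm i
      · simpa using abs_partsCoeff_le hm' i
    · rintro (i | i)
      · exact Finset.mem_Icc.2 (hN1 i)
      · exact Finset.mem_Icc.2 (hN2 i)
    · rintro (i | i) (j | j) hg h
      · exact congrArg _ (hx h)
      · simp at hg
      · simp at hg
      · exact congrArg _ (hx' h)
    · rintro (_ | _) <;> simp [hzero]
    · have e1 := sum_partsCoeff_mul m fun i => (a (x i) : ℤ)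
      have e2 := sum_partsCoeff_mul m' fun i => (a (x' i) : ℤ)
      simp only [Fintype.sum_sum_type, Sum.elim_inl, Sum.elim_inr, Pi.neg_apply, neg_mul,
        Finset.sum_neg_distrib]
      rw [e1, e2, ← sub_eq_add_neg, sub_eq_zero]
      exact heq
  · rintro ⟨⟨m, x⟩, ⟨m', x'⟩⟩ - ⟨⟨l, y⟩, ⟨l', y'⟩⟩ - h
    simp only [Prod.mk.injEq, Sum.elim_eq_iff, neg_inj] at h
    obtain ⟨⟨h1, h2⟩, h3, h4⟩ := h
    rw [partsCoeff_injective h1, partsCoeff_injective h2, h3, h4]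
  · push_cast
    calc (2 : ℝ) ^ (2 * (n + 1)) * ((2 * (n + 1)).factorial *
          ((N : ℝ) ^ (2 * (n + 1) - 1) * (10 * L) ^ (2 * (n + 1) - 1)))
        ≤ (2 : ℝ) ^ (2 * (n + 1)) * ((2 * (n + 1)).factorial *
          ((N : ℝ) ^ (2 * (n + 1) - 1) * (10 * (C * Real.log N)) ^ (2 * (n + 1) - 1))) := by
          gcongr
      _ = _ := by rw [← mul_assoc 10 C, mul_pow (10 * C)]; ring
end

section
/- Let $c > 1$ and let $a : \mathbb{N} \to \mathbb{N}$ satisfy $a(n+1) > c \cdot a(n)$ for all $n$. Let $r \ge 1$. Call a solution $(y_1,\dots,y_r,z_1,\dots,z_r)$ of the system $\sum_{i=1}^r y_i a(z_i) = 0$, $\sum_{i=1}^r y_i = 0$ (with $y_i \in \mathbb{Z}$, $z_i$ positive integers, all bounded by $N$ in absolute value) non-degenerate if there exists an index $i$ with $\sum_{j : z_j = z_i} y_j \ne 0$. Then the number of non-degenerate solutions is at most $C(r,c) \cdot N^{r-1} (\log N)^{r-1}$ for all $N \ge 2$. -/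
section

open Finset

/-- The solutions `(y, z)` whose indices are clustered by `β`: the `z`-values in one cluster lie
within `H` of each other, and `a ∘ z` drops by a factor at least `3 * r * N` from one cluster to
the next.  The cluster of `p` is the last one in which `y` need not sum to zero; either it contains
an index `q` with `z q ≠ z p`, or (when `q = p`) `z` is constant on it and `y` does not sum to zero
there. -/
def clusteredSolutions (a : ℕ → ℕ) (r N H : ℕ) (β : Fin r → Fin (r + 1)) (p q : Fin r) :
    Set ((Fin r → ℤ) × (Fin r → ℕ)) :=
  {s | (∀ i, |s.1 i| ≤ (N : ℤ)) ∧ (∀ i, 1 ≤ s.2 i ∧ s.2 i ≤ N) ∧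
    (∑ i, s.1 i * (a (s.2 i) : ℤ)) = 0 ∧ (∑ i, s.1 i) = 0 ∧
    (∀ i j, β i = β j → |(s.2 i : ℤ) - s.2 j| ≤ H) ∧
    (∀ i j, β i < β j → 3 * r * N * a (s.2 j) ≤ a (s.2 i)) ∧
    (∀ b, β p < b → ∑ i with β i = b, s.1 i = 0) ∧
    β q = β p ∧ (p ≠ q → s.2 p ≠ s.2 q) ∧
    (p = q → (∀ i, β i = β p → s.2 i = s.2 p) ∧ ∑ i with β i = β p, s.1 i ≠ 0)}

/-- The data recorded about a clustered solution, given a representative `ρ i` of the cluster of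
each index `i`. -/
def clusterCode {r : ℕ} (ρ : Fin r → Fin r) (p q : Fin r) (s : (Fin r → ℤ) × (Fin r → ℕ)) :
    Fin r → ℤ × ℤ := fun i =>
  (if ρ i = i ∨ i = q then 0 else s.1 i,
   if ρ i = i then (if p = q ∧ i = p then 0 else (s.2 i : ℤ)) else (s.2 i : ℤ) - s.2 (ρ i))

lemma exists_representatives {ι κ : Type*} (β : ι → κ) (p : ι) :
    ∃ ρ : ι → ι, (∀ i, β (ρ i) = β i) ∧ (∀ i j, β i = β j → ρ i = ρ j) ∧ ρ p = p := by
  classical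
  have : Nonempty ι := ⟨p⟩
  refine ⟨fun i => if β i = β p then p else Function.invFun β (β i), fun i => ?_,
    fun i j h => by simp only [h], by simp⟩
  dsimp only
  split_ifs with h
  · exact h.symm
  · exact Function.invFun_eq ⟨i, rfl⟩

lemma two_mul_abs_tail_lt {a : ℕ → ℕ} (ha : ∀ n, 0 < a n) {r N : ℕ} {y : Fin r → ℤ}
    {z : Fin r → ℕ} (hy : ∀ i, |y i| ≤ (N : ℤ)) (s : Finset (Fin r)) (i : Fin r)
    (hs : ∀ j ∈ s, 3 * r * N * a (z j) ≤ a (z i)) :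
    2 * |∑ j ∈ s, y j * (a (z j) : ℤ)| < a (z i) := by
  have hr : (0 : ℤ) < r := by exact_mod_cast i.pos
  have hai : (0 : ℤ) < a (z i) := by exact_mod_cast ha _
  have h1 : |∑ j ∈ s, y j * (a (z j) : ℤ)| ≤ ∑ j ∈ s, (N : ℤ) * a (z j) := by
    refine (abs_sum_le_sum_abs _ _).trans (sum_le_sum fun j _ => ?_)
    rw [abs_mul, Nat.abs_cast]
    exact mul_le_mul_of_nonneg_right (hy j) (by positivity)
  have h2 : (3 * r : ℤ) * ∑ j ∈ s, (N : ℤ) * a (z j) ≤ r * a (z i) := by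
    rw [mul_sum]
    calc ∑ j ∈ s, (3 * r : ℤ) * ((N : ℤ) * a (z j)) ≤ ∑ j ∈ s, (a (z i) : ℤ) := by
          refine sum_le_sum fun j hj => ?_
          have := hs j hj
          rw [← mul_assoc]
          exact_mod_cast this
      _ = (#s : ℤ) * a (z i) := by simp
      _ ≤ r * a (z i) := by
          refine mul_le_mul_of_nonneg_right ?_ hai.le
          exact_mod_cast (card_le_univ s).trans (by simp)
  have h3 : 3 * ∑ j ∈ s, (N : ℤ) * a (z j) ≤ a (z i) := by
    refine le_of_mul_le_mul_left ?_ hr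
    linarith
  have := abs_nonneg (∑ j ∈ s, y j * (a (z j) : ℤ))
  linarith

lemma eq_of_mul_sub_add_eq_zero {A x x' t t' : ℤ} (h : (x - x') * A + (t - t') = 0)
    (ht : 2 * |t| < A) (ht' : 2 * |t'| < A) : x = x' := by
  have hA : 0 < A := lt_of_le_of_lt (by positivity) ht
  by_contra hne
  have h1 : 1 ≤ |x - x'| := Int.one_le_abs (sub_ne_zero.2 hne)
  have h2 : |x - x'| * A = |t' - t| := by
    nth_rw 1 [← abs_of_pos hA]
    rw [← abs_mul]
    congr 1
    linarith
  have h3 := abs_sub t' t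
  nlinarith

lemma clusterCode_injOn {a : ℕ → ℕ} (ha : ∀ n, 0 < a n) (hinj : Function.Injective a)
    {r N H : ℕ} {β : Fin r → Fin (r + 1)} {p q : Fin r} {ρ : Fin r → Fin r}
    (hβρ : ∀ i, β (ρ i) = β i) (hρ : ∀ i j, β i = β j → ρ i = ρ j) (hp : ρ p = p) :
    Set.InjOn (clusterCode ρ p q) (clusteredSolutions a r N H β p q) := by
  rintro ⟨y, z⟩ ⟨hyN, -, hya, hys, -, hgap, hlate, hqp, hne, heq⟩
    ⟨y', z'⟩ ⟨hyN', -, hya', hys', -, hgap', hlate', -, hne', heq'⟩ hcode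
  dsimp only at *
  have hy : ∀ i, ρ i ≠ i → i ≠ q → y i = y' i := fun i h1 h2 => by
    simpa [clusterCode, h1, h2] using congrArg Prod.fst (congrFun hcode i)
  have hrep : ∀ i, ρ i = i → ¬(p = q ∧ i = p) → z i = z' i := fun i h1 h2 => by
    simpa only [clusterCode, h1, h2, if_true, if_false, Nat.cast_inj]
      using congrArg Prod.snd (congrFun hcode i)
  have hdiff : ∀ i, ρ i ≠ i → (z i : ℤ) - z (ρ i) = z' i - z' (ρ i) := fun i h1 => by
    simpa only [clusterCode, h1, if_false] using congrArg Prod.snd (congrFun hcode i)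
  have hz : ∀ i, ¬(p = q ∧ β i = β p) → z i = z' i := by
    intro i hi
    have h1 : z (ρ i) = z' (ρ i) := hrep _ (hρ _ _ (hβρ i)) fun h => hi ⟨h.1, by rw [← hβρ, h.2]⟩
    by_cases h : ρ i = i
    · rwa [h] at h1
    · have := hdiff i h
      omega
  have hearly : ∀ b, b < β p → ∀ i, β i = b → y i = y' i := by
    intro b
    induction b using WellFoundedLT.induction with
    | ind b ih =>
      intro hb i hi
      have hiq : i ≠ q := by rintro rfl; exact hb.ne (hi.symm.trans hqp)
      by_cases hri : ρ i = i
      · have hzi : z i = z' i := hz i fun h => hb.ne (hi.symm.trans h.2)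
        have key : ∀ j, y j * (a (z j) : ℤ) - y' j * a (z' j) =
            (if j = i then (y i - y' i) * (a (z i) : ℤ) else 0) +
            (if b < β j then y j * (a (z j) : ℤ) - y' j * a (z' j) else 0) := by
          intro j
          by_cases hji : j = i
          · subst hji
            rw [if_pos rfl, if_neg (by simp [hi]), hzi]
            ring
          rw [if_neg hji, zero_add]
          split_ifs with hbj
          · rfl
          have hjp : β j < β p := (not_lt.1 hbj).trans_lt hb
          have hyj : y j = y' j := by
            rcases (not_lt.1 hbj).lt_or_eq with h | h
            · exact ih _ h (h.trans hb) j rfl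
            · refine hy j (fun h' => hji ?_) (by rintro rfl; exact hjp.ne hqp)
              rw [← h', hρ j i (h.trans hi.symm), hri]
          rw [hyj, hz j fun h => hjp.ne h.2, sub_self]
        have hsum := sum_congr rfl fun j (_ : j ∈ (univ : Finset (Fin r))) => key j
        rw [sum_sub_distrib, hya, hya', sum_add_distrib, sum_ite_eq' univ i, if_pos (mem_univ i),
          ← sum_filter, sum_sub_distrib] at hsum
        refine eq_of_mul_sub_add_eq_zero (hsum.symm.trans (sub_self 0))
          (two_mul_abs_tail_lt ha hyN _ i fun j hj => hgap i j ?_)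
          (hzi ▸ two_mul_abs_tail_lt ha hyN' _ i fun j hj => hgap' i j ?_) <;>
        · rw [hi]; exact (mem_filter.1 hj).2
      · exact hy i hri hiq
  have hlater : ∀ i, β p < β i → y i = y' i := by
    intro i hi
    have hiq : i ≠ q := by rintro rfl; exact hi.ne hqp.symm
    by_cases hri : ρ i = i
    · have h : ∑ j with β j = β i, (y j - y' j) = 0 := by
        rw [sum_sub_distrib, hlate _ hi, hlate' _ hi, sub_self]
      rw [sum_eq_single i] at h
      · exact sub_eq_zero.1 h
      · intro j hj hji
        have hj := (mem_filter.1 hj).2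
        rw [hy j (fun h' => hji (by rw [← h', hρ j i hj, hri]))
          (by rintro rfl; exact hi.ne (hqp.symm.trans hj)), sub_self]
      · simp
    · exact hy i hri hiq
  have hother : ∀ i, i ≠ p → i ≠ q → y i = y' i := by
    intro i hip hiq
    rcases lt_trichotomy (β i) (β p) with h | h | h
    · exact hearly _ h i rfl
    · exact hy i (fun h' => hip (by rw [← h', hρ i p h, hp])) hiq
    · exact hlater i h
  have hsub : ∑ j, (y j - y' j) = 0 := by rw [sum_sub_distrib, hys, hys', sub_self]
  by_cases hpq : p = q
  · subst hpq
    obtain ⟨hconst, hsum⟩ := heq rfl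
    obtain ⟨hconst', -⟩ := heq' rfl
    have hyy : y = y' := by
      funext i
      by_cases hip : i = p
      · subst hip
        rw [sum_eq_single i (fun j _ hj => sub_eq_zero.2 (hother j hj hj)) (by simp)] at hsub
        exact sub_eq_zero.1 hsub
      · exact hother i hip hip
    subst hyy
    have hzp : z p = z' p := by
      have key : ∀ j, y j * (a (z j) : ℤ) - y j * a (z' j) =
          if β j = β p then y j * ((a (z p) : ℤ) - a (z' p)) else 0 := by
        intro j
        split_ifs with h
        · rw [hconst j h, hconst' j h, mul_sub]
        · rw [hz j fun h' => h h'.2, sub_self]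
      have h := sum_congr rfl fun j (_ : j ∈ (univ : Finset (Fin r))) => key j
      rw [sum_sub_distrib, hya, hya', ← sum_filter, ← sum_mul, sub_self] at h
      have h := (mul_eq_zero.1 h.symm).resolve_left hsum
      exact hinj (by exact_mod_cast sub_eq_zero.1 h)
    have hzz : z = z' := by
      funext i
      by_cases h : β i = β p
      · rw [hconst i h, hconst' i h, hzp]
      · exact hz i fun h' => h h'.2
    rw [hzz]
  · have hzz : z = z' := funext fun i => hz i fun h => hpq h.1
    subst hzz
    have h1 : (y p - y' p) + (y q - y' q) = 0 := by
      rwa [sum_eq_add p q hpq (fun j _ hj => sub_eq_zero.2 (hother j hj.1 hj.2))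
        (by simp) (by simp)] at hsub
    have h2 : (y p - y' p) * (a (z p) : ℤ) + (y q - y' q) * a (z q) = 0 := by
      have h : ∑ j, (y j - y' j) * (a (z j) : ℤ) = 0 := by
        simp only [sub_mul]
        rw [sum_sub_distrib, hya, hya', sub_self]
      rwa [sum_eq_add p q hpq (fun j _ hj => by rw [hother j hj.1 hj.2, sub_self, zero_mul])
        (by simp) (by simp)] at h
    have h3 : (y p - y' p) * ((a (z p) : ℤ) - a (z q)) = 0 := by
      linear_combination h2 - (a (z q) : ℤ) * h1
    have h4 : (a (z p) : ℤ) - a (z q) ≠ 0 := fun h =>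
      hne hpq (hinj (by exact_mod_cast sub_eq_zero.1 h))
    have h5 : y p - y' p = 0 := (mul_eq_zero.1 h3).resolve_right h4
    have hyy : y = y' := by
      funext i
      by_cases hip : i = p
      · subst hip; omega
      by_cases hiq : i = q
      · subst hiq; omega
      exact hother i hip hiq
    rw [hyy]

lemma ncard_clusteredSolutions_le {a : ℕ → ℕ} (ha : ∀ n, 0 < a n) (hinj : Function.Injective a)
    {r N : ℕ} (hN : 1 ≤ N) (H : ℕ) (β : Fin r → Fin (r + 1)) (p q : Fin r) :
    (clusteredSolutions a r N H β p q).ncard ≤ (3 * N * (2 * H + 1)) ^ (r - 1) := by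
  rcases (clusteredSolutions a r N H β p q).eq_empty_or_nonempty with hemp | ⟨s₀, hs₀⟩
  · simp [hemp]
  have hqp : β q = β p := hs₀.2.2.2.2.2.2.2.1
  obtain ⟨ρ, hβρ, hρ, hp⟩ := exists_representatives β p
  let T₁ : Fin r → Finset ℤ := fun i => if ρ i = i ∨ i = q then {0} else Icc (-(N : ℤ)) N
  let T₂ : Fin r → Finset ℤ := fun i =>
    if ρ i = i then (if p = q ∧ i = p then {0} else Icc 1 (N : ℤ)) else Icc (-(H : ℤ)) H
  have hmaps : ∀ s ∈ clusteredSolutions a r N H β p q, clusterCode ρ p q s ∈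
      (Fintype.piFinset fun i => T₁ i ×ˢ T₂ i : Finset (Fin r → ℤ × ℤ)) := by
    rintro s ⟨hy, hz, -, -, hH, -⟩
    rw [Fintype.mem_piFinset]
    intro i
    rw [mem_product]
    constructor
    · simp only [clusterCode, T₁]
      split_ifs
      · simp
      · exact mem_Icc.2 (abs_le.1 (hy i))
    · simp only [clusterCode, T₂]
      split_ifs
      · simp
      · have := hz i
        rw [mem_Icc]
        omega
      · exact mem_Icc.2 (abs_le.1 (hH i (ρ i) (hβρ i).symm))
  have hcard := Set.ncard_le_ncard_of_injOn (t := ↑(Fintype.piFinset fun i => T₁ i ×ˢ T₂ i))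
    _ hmaps (clusterCode_injOn ha hinj hβρ hρ hp) (Finset.finite_toSet _)
  rw [Set.ncard_coe_finset, Fintype.card_piFinset] at hcard
  refine hcard.trans ?_
  simp only [card_product]
  have hA : #(Icc (-(N : ℤ)) N) ≤ 3 * N := by rw [Int.card_Icc]; omega
  have hH : #(Icc (-(H : ℤ)) H) ≤ 2 * H + 1 := by rw [Int.card_Icc]; omega
  have hN' : #(Icc 1 (N : ℤ)) ≤ 3 * N := by rw [Int.card_Icc]; omega
  have hT₁ : ∀ i, #(T₁ i) ≤ 3 * N := fun i => by
    simp only [T₁]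
    split_ifs
    · rw [card_singleton]; omega
    · exact hA
  have hall : ∀ i, #(T₁ i) * #(T₂ i) ≤ 3 * N * (2 * H + 1) := by
    intro i
    by_cases hi : ρ i = i
    · simp only [T₁, T₂, hi, true_or, if_true, card_singleton, one_mul]
      refine le_trans ?_ (Nat.le_mul_of_pos_right _ (Nat.succ_pos _))
      split_ifs
      · rw [card_singleton]; omega
      · exact hN'
    · refine Nat.mul_le_mul (hT₁ i) ?_
      simp only [T₂, hi, if_false]
      exact hH
  rw [← mul_prod_erase univ _ (mem_univ p)]
  by_cases hpq : p = q
  · have h1 : #(T₁ p) * #(T₂ p) = 1 := by simp [T₁, T₂, hp, ← hpq]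
    rw [h1, one_mul]
    refine (prod_le_pow_card _ _ _ fun i _ => hall i).trans ?_
    simp
  · have hqmem : q ∈ univ.erase p := mem_erase.2 ⟨Ne.symm hpq, mem_univ q⟩
    have hρq : ρ q ≠ q := by rw [hρ q p hqp, hp]; exact hpq
    have h1 : #(T₁ p) * #(T₂ p) ≤ 3 * N := by
      simpa [T₁, T₂, hp, hpq] using hN'
    have h2 : #(T₁ q) * #(T₂ q) ≤ 2 * H + 1 := by
      simpa only [T₁, T₂, hρq, or_true, if_true, if_false, card_singleton, one_mul] using hH
    have hr : r - 1 = (r - 2) + 1 := by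
      have : #({p, q} : Finset (Fin r)) ≤ r := (card_le_univ _).trans (by simp)
      rw [card_pair hpq] at this
      omega
    rw [← mul_prod_erase _ _ hqmem, ← mul_assoc, hr, pow_succ']
    refine Nat.mul_le_mul (Nat.mul_le_mul h1 h2) ?_
    refine (prod_le_pow_card _ _ _ fun i _ => hall i).trans ?_
    rw [card_erase_of_mem hqmem, card_erase_of_mem (mem_univ p), card_univ, Fintype.card_fin,
      Nat.sub_sub]

lemma finite_clusteredSolutions (a : ℕ → ℕ) (r N H : ℕ) (β : Fin r → Fin (r + 1)) (p q : Fin r) :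
    (clusteredSolutions a r N H β p q).Finite := by
  refine ((Set.finite_Icc (fun _ => -(N : ℤ)) (fun _ => (N : ℤ))).prod
    (Set.finite_Icc (fun _ => 1) (fun _ => N))).subset ?_
  rintro s ⟨hy, hz, -⟩
  exact ⟨⟨fun i => (abs_le.1 (hy i)).1, fun i => (abs_le.1 (hy i)).2⟩,
    ⟨fun i => (hz i).1, fun i => (hz i).2⟩⟩

/-- Finitely many naturals split into clusters of diameter at most `r * G`, numbered downwards,
with distinct clusters more than `G` apart. -/
lemma exists_clustering (G : ℕ) {r : ℕ} (z : Fin r → ℕ) :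
    ∃ β : Fin r → Fin (r + 1), (∀ i j, β i = β j → |(z i : ℤ) - z j| ≤ (r * G : ℕ)) ∧
      ∀ i j, β i < β j → z j + G < z i := by
  classical
  set V : Finset ℕ := univ.image z
  have hVr : #V ≤ r := card_image_le.trans (by simp)
  have hzV : ∀ i, z i ∈ V := fun i => mem_image_of_mem z (mem_univ i)
  let cuts : Finset ℕ := {v ∈ V | ∀ w ∈ V, v < w → v + G < w}
  let S : ℕ → Finset ℕ := fun m => {v ∈ cuts | m ≤ v}
  have hS : ∀ {m n}, m ≤ n → S n ⊆ S m := fun h v hv => by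
    simp only [S, mem_filter] at hv ⊢
    exact ⟨hv.1, h.trans hv.2⟩
  have hchain : ∀ w ∈ V, ∀ k v, w - v = k → v ∈ V → v ≤ w → S v ⊆ S w →
      w ≤ v + #{u ∈ V | v < u ∧ u ≤ w} * G := by
    intro w hw k
    induction k using Nat.strong_induction_on with
    | _ k ih =>
      intro v hk hv hvw hsub
      rcases hvw.eq_or_lt with rfl | hlt
      · omega
      have hcut : v ∉ cuts := fun h => by
        have := hsub (mem_filter.2 ⟨h, le_rfl⟩)
        exact absurd (mem_filter.1 this).2 (not_le.2 hlt)
      have : ∃ u ∈ V, v < u ∧ u ≤ v + G := by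
        by_contra! h
        exact hcut (mem_filter.2 ⟨hv, h⟩)
      obtain ⟨u, hu, hvu, huG⟩ := this
      rcases le_total w u with hwu | huw
      · have h1 : 1 ≤ #{u ∈ V | v < u ∧ u ≤ w} :=
          card_pos.2 ⟨w, mem_filter.2 ⟨hw, hlt, le_rfl⟩⟩
        have := Nat.mul_le_mul_right G h1
        omega
      · have h1 := ih (w - u) (by omega) u rfl hu huw ((hS hvu.le).trans hsub)
        have h2 : #{x ∈ V | u < x ∧ x ≤ w} + 1 ≤ #{x ∈ V | v < x ∧ x ≤ w} := by
          refine card_lt_card (ssubset_iff_of_subset (fun x hx => ?_) |>.2 ⟨u, ?_, ?_⟩)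
          · rw [mem_filter] at hx ⊢
            exact ⟨hx.1, hvu.trans hx.2.1, hx.2.2⟩
          · exact mem_filter.2 ⟨hu, hvu, huw⟩
          · simp
        have := Nat.mul_le_mul_right G h2
        rw [add_mul] at this
        omega
  have hclose : ∀ i j, z j ≤ z i → #(S (z i)) = #(S (z j)) → z i ≤ z j + r * G := by
    intro i j hji hcard
    refine (hchain (z i) (hzV i) _ (z j) rfl (hzV j) hji
      (eq_of_subset_of_card_le (hS hji) hcard.ge).ge).trans ?_
    exact Nat.add_le_add_left (Nat.mul_le_mul_right _ ((card_filter_le _ _).trans hVr)) _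
  refine ⟨fun i => ⟨#(S (z i)), Nat.lt_succ_of_le
    (((card_filter_le _ _).trans (card_filter_le _ _)).trans hVr)⟩, fun i j h => ?_, fun i j h => ?_⟩
  · have h : #(S (z i)) = #(S (z j)) := Fin.mk.inj h
    rw [abs_le]
    rcases le_total (z j) (z i) with hji | hij
    · have := hclose i j hji h
      omega
    · have := hclose j i hij h.symm
      omega
  · have h : #(S (z i)) < #(S (z j)) := h
    obtain ⟨v, hv, hvi⟩ := exists_mem_notMem_of_card_lt_card h
    simp only [S, mem_filter] at hv hvi
    have hvz : v < z i := not_le.1 fun h' => hvi ⟨hv.1, h'⟩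
    have := (mem_filter.1 hv.1).2 _ (hzV i) hvz
    omega

lemma pow_mul_le_of_lacunary {c : ℝ} (hc : 1 < c) {a : ℕ → ℕ} (h : ∀ n, c * a n < a (n + 1))
    (m k : ℕ) : c ^ k * a m ≤ a (m + k) := by
  induction k with
  | zero => simp
  | succ k ih =>
    calc c ^ (k + 1) * a m = c * (c ^ k * a m) := by ring
      _ ≤ c * a (m + k) := mul_le_mul_of_nonneg_left ih (by linarith)
      _ ≤ a (m + (k + 1)) := (h _).le

lemma exists_gap {c : ℝ} (hc : 1 < c) {r : ℕ} (hr : 1 ≤ r) :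
    ∃ K : ℝ, ∀ N : ℕ, 2 ≤ N → ∃ G : ℕ, (3 * r * N : ℝ) ≤ c ^ G ∧
      ((2 * (r * G) + 1 : ℕ) : ℝ) ≤ K * Real.log N := by
  have hr' : (1 : ℝ) ≤ r := by exact_mod_cast hr
  have hlc : 0 < Real.log c := Real.log_pos hc
  have hl2 : 0 < Real.log 2 := Real.log_pos one_lt_two
  have hl3 : 0 ≤ Real.log (3 * r) := Real.log_nonneg (by linarith)
  refine ⟨2 * r * ((Real.log (3 * r) / Real.log 2 + 1) / Real.log c + 1 / Real.log 2) +
    1 / Real.log 2, fun N hN => ?_⟩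
  have hN' : (2 : ℝ) ≤ N := by exact_mod_cast hN
  have hlN : Real.log 2 ≤ Real.log N := Real.log_le_log two_pos hN'
  have h1 : 1 ≤ 1 / Real.log 2 * Real.log N := by
    rw [one_div, inv_mul_eq_div, one_le_div hl2]; exact hlN
  have h3 : Real.log (3 * r) ≤ Real.log (3 * r) / Real.log 2 * Real.log N := by
    have := mul_le_mul_of_nonneg_left h1 hl3
    calc _ = Real.log (3 * r) * 1 := by ring
      _ ≤ _ := this
      _ = _ := by ring
  have hlog : Real.log (3 * r * N) = Real.log (3 * r) + Real.log N :=
    Real.log_mul (by positivity) (by positivity)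
  set G := ⌈Real.log (3 * r * N) / Real.log c⌉₊
  have hGle : (G : ℝ) ≤ ((Real.log (3 * r) / Real.log 2 + 1) / Real.log c + 1 / Real.log 2) *
      Real.log N := by
    have h4 : Real.log (3 * r * N) / Real.log c ≤
        (Real.log (3 * r) / Real.log 2 + 1) / Real.log c * Real.log N := by
      rw [div_mul_eq_mul_div]
      refine div_le_div_of_nonneg_right ?_ hlc.le
      linarith
    have h5 : 0 ≤ Real.log (3 * r * N) / Real.log c := by
      rw [hlog]
      exact div_nonneg (by linarith) hlc.le
    have := (Nat.ceil_lt_add_one h5).le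
    linarith
  have h6 : 2 * (r : ℝ) * G ≤ _ := mul_le_mul_of_nonneg_left hGle (by positivity)
  refine ⟨G, ?_, ?_⟩
  · rw [← Real.log_le_log_iff (by positivity) (by positivity), Real.log_pow, ← div_le_iff₀ hlc]
    exact Nat.le_ceil _
  · push_cast
    linarith

lemma exists_mem_clusteredSolutions {a : ℕ → ℕ} {r N G : ℕ}
    (hG : ∀ m n, m + G < n → 3 * r * N * a m ≤ a n)
    {y : Fin r → ℤ} {z : Fin r → ℕ} (hy : ∀ i, |y i| ≤ (N : ℤ)) (hz : ∀ i, 1 ≤ z i ∧ z i ≤ N)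
    (hya : ∑ i, y i * (a (z i) : ℤ) = 0) (hys : ∑ i, y i = 0)
    (hnd : ∃ i, ∑ j with z j = z i, y j ≠ 0) :
    ∃ β p q, (y, z) ∈ clusteredSolutions a r N (r * G) β p q := by
  obtain ⟨β, hclose, hfar⟩ := exists_clustering G z
  have hβz : ∀ {i j}, z i = z j → β i = β j := by
    intro i j h
    by_contra hne
    rcases lt_or_gt_of_ne hne with h' | h' <;> have := hfar _ _ h' <;> omega
  obtain ⟨p, hp, hmax⟩ := exists_max_image ({i | ∑ j with z j = z i, y j ≠ 0} : Finset (Fin r)) β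
    (hnd.imp fun i hi => mem_filter.2 ⟨mem_univ i, hi⟩)
  have hp := (mem_filter.1 hp).2
  have hlate : ∀ b, β p < b → ∑ i with β i = b, y i = 0 := by
    intro b hb
    rw [← sum_fiberwise_of_maps_to (g := z) (t := univ.image z)
      fun i _ => mem_image_of_mem z (mem_univ i)]
    refine sum_eq_zero fun v _ => ?_
    by_cases hv : ∃ i, β i = b ∧ z i = v
    · obtain ⟨i, hi, rfl⟩ := hv
      have h0 : ∑ j with z j = z i, y j = 0 := by
        by_contra hne
        exact absurd (hmax i (mem_filter.2 ⟨mem_univ i, hne⟩)) (not_le.2 (hi ▸ hb))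
      rw [← h0, filter_filter]
      refine sum_congr (filter_congr fun j _ => ⟨And.right, fun h => ⟨(hβz h).trans hi, h⟩⟩)
        fun _ _ => rfl
    · refine sum_eq_zero fun i hi => ?_
      rw [filter_filter, mem_filter] at hi
      exact absurd ⟨i, hi.2⟩ hv
  have hgap : ∀ i j, β i < β j → 3 * r * N * a (z j) ≤ a (z i) :=
    fun i j h => hG _ _ (hfar i j h)
  by_cases h : ∃ q, β q = β p ∧ z p ≠ z q
  · obtain ⟨q, hq, hpq⟩ := h
    exact ⟨β, p, q, hy, hz, hya, hys, hclose, hgap, hlate, hq, fun _ => hpq,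
      fun h => absurd (congrArg z h) hpq⟩
  · push Not at h
    refine ⟨β, p, p, hy, hz, hya, hys, hclose, hgap, hlate, rfl, fun h => absurd rfl h,
      fun _ => ⟨fun i hi => (h i hi).symm, ?_⟩⟩
    rwa [filter_congr fun i _ => (⟨fun hi => (h i hi).symm, hβz⟩ : β i = β p ↔ z i = z p)]

end

/-- Non-degenerate solutions of `∑ y i * a (z i) = 0`, `∑ y i = 0` (the `z i` not
necessarily distinct) number `O_{r,c}(N^(r-1) (log N)^(r-1))`.  A solution is
non-degenerate if for some index `i` the sum of the `y j` over all `j` with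
`z j = z i` is nonzero. -/
theorem stmt4 (c : ℝ) (hc : 1 < c) (r : ℕ) (hr : 1 ≤ r) :
    ∃ κ : ℝ, ∀ (a : ℕ → ℕ), (∀ n, 0 < a n) → (∀ n, c * a n < a (n + 1)) →
      ∀ (N : ℕ), 2 ≤ N →
        (Set.ncard {p : (Fin r → ℤ) × (Fin r → ℕ) |
            (∀ i, |p.1 i| ≤ (N : ℤ)) ∧ (∀ i, 1 ≤ p.2 i ∧ p.2 i ≤ N) ∧
            (∑ i, p.1 i * (a (p.2 i) : ℤ)) = 0 ∧ (∑ i, p.1 i) = 0 ∧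
            (∃ i, (∑ j ∈ Finset.univ.filter fun j => p.2 j = p.2 i, p.1 j) ≠ 0)} : ℝ)
          ≤ κ * (N : ℝ) ^ (r - 1) * (Real.log N) ^ (r - 1) := by
  obtain ⟨K, hK⟩ := exists_gap hc hr
  let ι := (Fin r → Fin (r + 1)) × Fin r × Fin r
  refine ⟨Fintype.card ι * (3 * K) ^ (r - 1), fun a ha hlac N hN => ?_⟩
  obtain ⟨G, hcG, hGK⟩ := hK N hN
  have hmono : StrictMono a := strictMono_nat_of_lt_succ fun n => by
    have h1 : (0 : ℝ) < a n := by exact_mod_cast ha n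
    have h2 : (a n : ℝ) < a (n + 1) := by nlinarith [hlac n]
    exact_mod_cast h2
  have hgrow : ∀ m n, m + G < n → 3 * r * N * a m ≤ a n := by
    intro m n h
    have h1 : (3 * r * N : ℝ) * a m ≤ a (m + G) :=
      (mul_le_mul_of_nonneg_right hcG (Nat.cast_nonneg _)).trans (pow_mul_le_of_lacunary hc hlac m G)
    have h2 : 3 * r * N * a m ≤ a (m + G) := by exact_mod_cast h1
    exact h2.trans (hmono h).le
  let U : Set ((Fin r → ℤ) × (Fin r → ℕ)) :=
    ⋃ t : ι, clusteredSolutions a r N (r * G) t.1 t.2.1 t.2.2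
  have hU : U.Finite :=
    Set.finite_iUnion fun t => finite_clusteredSolutions a r N _ t.1 t.2.1 t.2.2
  have hcount : U.ncard ≤ Fintype.card ι * (3 * N * (2 * (r * G) + 1)) ^ (r - 1) :=
    calc U.ncard ≤ ∑ t : ι, (clusteredSolutions a r N (r * G) t.1 t.2.1 t.2.2).ncard :=
          Set.ncard_iUnion_le_of_fintype _
      _ ≤ ∑ _t : ι, (3 * N * (2 * (r * G) + 1)) ^ (r - 1) := Finset.sum_le_sum fun t _ =>
          ncard_clusteredSolutions_le ha hmono.injective (by omega) _ _ _ _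
      _ = _ := by rw [Finset.sum_const, Finset.card_univ, smul_eq_mul]
  calc _ ≤ (U.ncard : ℝ) := by
        refine Nat.cast_le.2 (Set.ncard_le_ncard ?_ hU)
        rintro ⟨y, z⟩ ⟨hy, hz, hya, hys, hnd⟩
        obtain ⟨β, p, q, h⟩ := exists_mem_clusteredSolutions hgrow hy hz hya hys hnd
        exact Set.mem_iUnion.2 ⟨(β, p, q), h⟩
    _ ≤ ((Fintype.card ι * (3 * N * (2 * (r * G) + 1)) ^ (r - 1) : ℕ) : ℝ) :=
        Nat.cast_le.2 hcount
    _ = Fintype.card ι * (3 * N * ((2 * (r * G) + 1 : ℕ) : ℝ)) ^ (r - 1) := by push_cast; rfl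
    _ ≤ Fintype.card ι * (3 * N * (K * Real.log N)) ^ (r - 1) := by gcongr
    _ = _ := by simp only [mul_pow]; ring
end
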